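/- arXiv:1301.3003 — 7 statements merged into one kernel-verified Lean document; each statement's English description precedes it below -/
import Mathlib

section
/- Let V_1, …, V_n be finite-dimensional subspaces of a vector space E over a field F and let D(V_1,…,V_n) = {x ∈ ℤ_{≥0}^n : ∑_{i∈A} x_i ≤ dim(∑_{i∈A} V_i) for all A ⊆ {1,…,n}}. Then D(V_1,…,V_n) is a discrete polymatroid: it is a nonempty finite subset of ℤ_{≥0}^n, it is closed under taking integral sub-vectors, and for all u, v ∈ D(V_1,…,V_n) with |u| < |v| there exists w ∈ D(V_1,…,V_n) with u < w ≤ u ∨ v. -/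
/-- The discrete polymatroid `D(V 1, …, V n)` determined by subspaces `V 1, …, V n`
of a vector space `E` over a field `F`: the set of integer vectors `x` such that
`∑ i ∈ A, x i ≤ dim (∑ i ∈ A, V i)` for every `A ⊆ {1, …, n}`. -/
def polymatroidOfSubspaces {F E : Type*} [Field F] [AddCommGroup E] [Module F E] {n : ℕ}
    (V : Fin n → Submodule F E) : Set (Fin n → ℕ) :=
  {x | ∀ A : Finset (Fin n), ∑ i ∈ A, x i ≤ Module.finrank F ↥(∑ i ∈ A, V i)}

open Finset in
/-- Augmentation for the integer vectors dominated by a submodular set function vanishing at `∅`. -/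
theorem exists_lt_le_sup_of_submodular {ι : Type*} [Fintype ι] [DecidableEq ι]
    {f : Finset ι → ℕ} (hf₀ : f ∅ = 0)
    (hf : ∀ A B, f (A ∪ B) + f (A ∩ B) ≤ f A + f B) {u v : ι → ℕ}
    (hu : ∀ A, ∑ i ∈ A, u i ≤ f A) (hv : ∀ A, ∑ i ∈ A, v i ≤ f A)
    (huv : ∑ i, u i < ∑ i, v i) :
    ∃ w : ι → ℕ, (∀ A, ∑ i ∈ A, w i ≤ f A) ∧ u < w ∧ w ≤ u ⊔ v := by
  have tight_union {A B : Finset ι} (hA : ∑ i ∈ A, u i = f A) (hB : ∑ i ∈ B, u i = f B) :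
      ∑ i ∈ A ∪ B, u i = f (A ∪ B) := by
    have hsum := sum_union_inter (s₁ := A) (s₂ := B) (f := u)
    have hAB := hf A B
    have hunion := hu (A ∪ B)
    have hinter := hu (A ∩ B)
    lia
  obtain ⟨i, hi, hit⟩ : ∃ i, u i < v i ∧ ∀ A, i ∈ A → ∑ j ∈ A, u j < f A := by
    by_contra! h
    choose! T hmem hT using h
    set U := ({i | u i < v i} : Finset ι).sup T
    have hU : ∑ j ∈ U, u j = f U := by
      refine sup_induction (p := fun A ↦ ∑ j ∈ A, u j = f A) (by simp [hf₀])
        (fun A hA B hB ↦ tight_union hA hB) fun i hi ↦ ?_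
      exact (hu _).antisymm (hT i (by simpa using hi))
    have hcompl : ∑ j ∈ Uᶜ, v j ≤ ∑ j ∈ Uᶜ, u j := by
      refine sum_le_sum fun j hj ↦ not_lt.mp fun hlt ↦ mem_compl.mp hj ?_
      have hle : T j ≤ U := le_sup (by simpa using hlt)
      exact hle (hmem j hlt)
    have hvU := hv U
    rw [← sum_add_sum_compl U u, ← sum_add_sum_compl U v] at huv
    lia
  refine ⟨u + Pi.single i 1, fun A ↦ ?_, ?_, fun j ↦ ?_⟩
  · simp only [Pi.add_apply, sum_add_distrib, sum_pi_single']
    split_ifs with hA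
    · exact hit A hA
    · exact hu A
  · exact lt_add_of_pos_right u (Pi.single_pos.mpr one_pos)
  · obtain rfl | hj := eq_or_ne j i
    · simp [hi]
    · simp [hj]

theorem Submodule.finrank_sum_union_add_finrank_sum_inter_le {F E ι : Type*} [DivisionRing F]
    [AddCommGroup E] [Module F E] [DecidableEq ι] (V : ι → Submodule F E)
    [∀ i, FiniteDimensional F (V i)] (A B : Finset ι) :
    Module.finrank F ↥(∑ i ∈ A ∪ B, V i) + Module.finrank F ↥(∑ i ∈ A ∩ B, V i) ≤
      Module.finrank F ↥(∑ i ∈ A, V i) + Module.finrank F ↥(∑ i ∈ B, V i) := by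
  have hsum (C : Finset ι) : ∑ i ∈ C, V i = C.sup V := by
    induction C using Finset.induction_on with
    | empty => simp
    | insert i C hi ih => rw [Finset.sum_insert hi, Finset.sup_insert, ih, Submodule.add_eq_sup]
  rw [hsum, hsum, hsum, hsum, Finset.sup_union,
    ← Submodule.finrank_sup_add_finrank_inf_eq (A.sup V)]
  gcongr
  exact Submodule.finrank_mono
    (le_inf (Finset.sup_mono Finset.inter_subset_left) (Finset.sup_mono Finset.inter_subset_right))

/-- **`D(V 1, …, V n)` is a discrete polymatroid.** It is a nonempty finite subset of
`ℤ_{≥0}^n`, closed under taking integral sub-vectors, and for all `u, v` in it with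
`|u| < |v|` there is `w` in it with `u < w ≤ u ⊔ v`. -/
theorem polymatroidOfSubspaces_isDiscretePolymatroid
    {F E : Type*} [Field F] [AddCommGroup E] [Module F E] {n : ℕ}
    (V : Fin n → Submodule F E) (hV : ∀ i, FiniteDimensional F (V i)) :
    (polymatroidOfSubspaces V).Nonempty ∧
    (polymatroidOfSubspaces V).Finite ∧
    (∀ u ∈ polymatroidOfSubspaces V, ∀ v : Fin n → ℕ, v ≤ u → v ∈ polymatroidOfSubspaces V) ∧
    (∀ u ∈ polymatroidOfSubspaces V, ∀ v ∈ polymatroidOfSubspaces V,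
      (∑ i, u i) < ∑ i, v i →
      ∃ w ∈ polymatroidOfSubspaces V, u < w ∧ w ≤ u ⊔ v) := by
  refine ⟨⟨0, fun A ↦ by simp⟩, ?_, fun u hu v hvu A ↦ ?_, fun u hu v hv huv ↦ ?_⟩
  · refine (Set.finite_Iic fun i ↦ Module.finrank F (V i)).subset fun x hx i ↦ ?_
    have hi := hx {i}
    rwa [Finset.sum_singleton, Finset.sum_singleton] at hi
  · exact (Finset.sum_le_sum fun i _ ↦ hvu i).trans (hu A)
  · exact exists_lt_le_sup_of_submodular (by rw [Finset.sum_empty]; exact finrank_bot F E)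
      (Submodule.finrank_sum_union_add_finrank_sum_inter_le V) hu hv huv
end

section
/- Let V_1, …, V_n be finite-dimensional subspaces of a vector space E over a field F, let a ∈ D(V_1,…,V_n), and let i ∈ {1,…,n} be such that a + ε_i ∉ D(V_1,…,V_n). Then there exists A ⊆ {1,…,n} with dim(∑_{j∈A} V_j) < ∑_{j∈A} (a+ε_i)_j, and every such A satisfies i ∈ A and dim(∑_{j∈A} V_j) = ∑_{j∈A} a_j. -/
/-- If `a ∈ D(V 1, …, V n)` but `a + ε i ∉ D(V 1, …, V n)`, then there is a set `A` with
`dim (∑ j ∈ A, V j) < ∑ j ∈ A, (a + ε i) j`, and every such `A` contains `i` and satisfies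
`dim (∑ j ∈ A, V j) = ∑ j ∈ A, a j`. -/
theorem exists_violating_set_of_add_single_not_mem
    {F E : Type*} [Field F] [AddCommGroup E] [Module F E] {n : ℕ}
    (V : Fin n → Submodule F E) (hV : ∀ i, FiniteDimensional F (V i))
    (a : Fin n → ℕ) (ha : a ∈ polymatroidOfSubspaces V) (i : Fin n)
    (hi : a + Pi.single i 1 ∉ polymatroidOfSubspaces V) :
    (∃ A : Finset (Fin n),
        Module.finrank F ↥(∑ j ∈ A, V j) < ∑ j ∈ A, ((a + Pi.single i 1 : Fin n → ℕ) j)) ∧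
    (∀ A : Finset (Fin n),
        Module.finrank F ↥(∑ j ∈ A, V j) < ∑ j ∈ A, ((a + Pi.single i 1 : Fin n → ℕ) j) →
        i ∈ A ∧ Module.finrank F ↥(∑ j ∈ A, V j) = ∑ j ∈ A, a j) := by
  refine ⟨by simpa only [polymatroidOfSubspaces, Set.mem_ofPred_eq, not_forall, not_le] using hi,
    fun A hA ↦ ?_⟩
  have hle := ha A
  simp only [Pi.add_apply, Finset.sum_add_distrib, Pi.single_apply, Finset.sum_ite_eq'] at hA
  split_ifs at hA with hiA
  · exact ⟨hiA, by omega⟩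
  · omega
end

section
/- Let V_1, …, V_n be finite-dimensional subspaces of a vector space E over a field F, let a ∈ D(V_1,…,V_n), and let i ∈ {1,…,n} be such that a + ε_i ∉ D(V_1,…,V_n). Then V_i ⊆ ∑_{j ∈ supp(a)} V_j; equivalently, dim(∑_{j ∈ supp(a+ε_i)} V_j) = dim(∑_{j ∈ supp(a)} V_j). -/
theorem Submodule.finset_sum_eq_sup {R M ι : Type*} [Semiring R] [AddCommMonoid M] [Module R M]
    (s : Finset ι) (V : ι → Submodule R M) : ∑ i ∈ s, V i = s.sup V := by
  classical
  induction s using Finset.induction_on with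
  | empty => simp
  | insert i s his ih => rw [Finset.sum_insert his, Finset.sup_insert, ih, Submodule.add_eq_sup]

/-- If `a ∈ D(V 1, …, V n)` but `a + ε i ∉ D(V 1, …, V n)`, then
`V i ⊆ ∑_{j ∈ supp(a)} V j`; equivalently,
`dim (∑_{j ∈ supp(a + ε i)} V j) = dim (∑_{j ∈ supp(a)} V j)`. -/
theorem subspace_le_sum_support_of_add_single_not_mem
    {F E : Type*} [Field F] [AddCommGroup E] [Module F E] {n : ℕ}
    (V : Fin n → Submodule F E) (hV : ∀ i, FiniteDimensional F (V i))
    (a : Fin n → ℕ) (ha : a ∈ polymatroidOfSubspaces V) (i : Fin n)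
    (hi : a + Pi.single i 1 ∉ polymatroidOfSubspaces V) :
    V i ≤ ∑ j ∈ (Finset.univ.filter fun j : Fin n => a j ≠ 0), V j ∧
    Module.finrank F
        ↥(∑ j ∈ (Finset.univ.filter fun j : Fin n => (a + Pi.single i 1 : Fin n → ℕ) j ≠ 0), V j)
      = Module.finrank F ↥(∑ j ∈ (Finset.univ.filter fun j : Fin n => a j ≠ 0), V j) := by
  classical
  have h_le : V i ≤ (Finset.univ.filter fun j : Fin n => a j ≠ 0).sup V := by
    simp only [polymatroidOfSubspaces, Set.mem_ofPred_eq, not_forall, not_le] at ha hi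
    obtain ⟨A, hA⟩ := hi
    have hiA : i ∈ A := by
      by_contra h
      refine hA.not_ge ((Finset.sum_congr rfl fun j hj => ?_).trans_le (ha A))
      simp [ne_of_mem_of_not_mem hj h]
    have hsum : ∑ j ∈ A, (a + Pi.single i 1 : Fin n → ℕ) j = ∑ j ∈ A, a j + 1 := by
      simp [Finset.sum_add_distrib, hiA]
    have hsupp : ∑ j ∈ A with a j ≠ 0, a j = ∑ j ∈ A, a j := Finset.sum_filter_ne_zero A
    have hB := ha (A.filter fun j => a j ≠ 0)
    rw [Submodule.finset_sum_eq_sup] at hA hB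
    have hsub : (A.filter fun j => a j ≠ 0).sup V ≤ A.sup V :=
      Finset.sup_mono (Finset.filter_subset _ _)
    have : FiniteDimensional F ↥(A.sup V) := Submodule.finiteDimensional_finset_sup A V
    have heq := Submodule.eq_of_le_of_finrank_le hsub (by omega)
    calc V i ≤ A.sup V := Finset.le_sup hiA
      _ = (A.filter fun j => a j ≠ 0).sup V := heq.symm
      _ ≤ _ := Finset.sup_mono (Finset.filter_subset_filter _ (Finset.subset_univ A))
  rw [Submodule.finset_sum_eq_sup, Submodule.finset_sum_eq_sup]
  refine ⟨h_le, congrArg (fun W : Submodule F E => Module.finrank F W) (le_antisymm ?_ ?_)⟩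
  · refine Finset.sup_le fun j hj => ?_
    obtain rfl | hji := eq_or_ne j i
    · exact h_le
    · exact Finset.le_sup (by simpa [hji] using hj)
  · exact Finset.sup_mono (Finset.monotone_filter_right _ fun j _ hj => by
      simp only [Pi.add_apply]; omega)
end

section
/- Let F be a field with more than two elements and let e_1 = (1,0), e_2 = (0,1) in F^2. Then there exist vectors m_3, m_4 ∈ F^2 such that e_2 ∈ span{e_1, m_3}, e_1 ∈ span{e_2, m_3}, e_2 ∈ span{e_1, m_4}, e_1 ∈ span{e_2, m_4}, e_1 ∈ span{m_3, m_4}, and e_2 ∈ span{m_3, m_4}. (This is precisely the statement that the network constructed in the paper from the discrete polymatroid of Example 1 admits a scalar linear solution over every field of size greater than two.) -/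
/-- Two vectors of `F²` with nonzero determinant span the whole plane. -/
theorem mem_span_pair_of_det_ne_zero {F : Type*} [Field F] {a b c d : F}
    (h : a * d - b * c ≠ 0) (x y : F) :
    ![x, y] ∈ Submodule.span F {![a, b], ![c, d]} := by
  rw [Submodule.mem_span_pair]
  refine ⟨(x * d - y * c) / (a * d - b * c), (a * y - b * x) / (a * d - b * c), ?_⟩
  ext i
  fin_cases i <;> simp [div_mul_eq_mul_div, ← add_div, div_eq_iff h] <;> ring

/-- **The network of Fig. 4 has a scalar linear solution over every field with more
than two elements (Lemma 2).** With messages having global encoding vectors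
`e₁ = (1,0)` and `e₂ = (0,1)` in `F²`, there exist global encoding vectors
`m₃, m₄ ∈ F²` for the two coded edges allowing every sink to decode its demand:
`x₂` from `(e₁, m₃)`, `x₁` from `(e₂, m₃)`, `x₂` from `(e₁, m₄)`, `x₁` from `(e₂, m₄)`,
and both `x₁, x₂` from `(m₃, m₄)`. -/
theorem scalar_linear_solution_of_two_lt_card (F : Type*) [Field F]
    (hF : 2 < Cardinal.mk F) :
    ∃ m₃ m₄ : Fin 2 → F,
      ![(0 : F), 1] ∈ Submodule.span F {![(1 : F), 0], m₃} ∧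
      ![(1 : F), 0] ∈ Submodule.span F {![(0 : F), 1], m₃} ∧
      ![(0 : F), 1] ∈ Submodule.span F {![(1 : F), 0], m₄} ∧
      ![(1 : F), 0] ∈ Submodule.span F {![(0 : F), 1], m₄} ∧
      ![(1 : F), 0] ∈ Submodule.span F {m₃, m₄} ∧
      ![(0 : F), 1] ∈ Submodule.span F {m₃, m₄} := by
  obtain ⟨a, ha⟩ := Cardinal.exists_notMem_of_length_lt [(0 : F), 1] (by simpa using hF)
  obtain ⟨ha0, ha1⟩ : a ≠ 0 ∧ a ≠ 1 := by simpa using ha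
  have hdet : (1 : F) * a - 1 * 1 ≠ 0 := by simpa [sub_eq_zero] using ha1
  exact ⟨![1, 1], ![1, a],
    mem_span_pair_of_det_ne_zero (by simp) 0 1,
    mem_span_pair_of_det_ne_zero (by simp) 1 0,
    mem_span_pair_of_det_ne_zero (by simpa using ha0) 0 1,
    mem_span_pair_of_det_ne_zero (by simp) 1 0,
    mem_span_pair_of_det_ne_zero hdet 1 0,
    mem_span_pair_of_det_ne_zero hdet 0 1⟩
end

section
/- Let e_1, e_2, e_3, e_4 be the standard basis of (F_2)^4, where F_2 is the field with two elements, and define the subspaces V_1 = span{e_1, e_2}, V_2 = span{e_3, e_4}, V_3 = span{e_1+e_4, e_2+e_3}, V_4 = span{e_1+e_3+e_4, e_2+e_4}. Then for every X ⊆ {1,2,3,4}, dim(∑_{i∈X} V_i) = 2|X| if |X| ≤ 2 and dim(∑_{i∈X} V_i) = 4 if |X| > 2. In particular, V_1, V_2, V_3, V_4 form a multi-linear representation of dimension 2 over F_2 of the uniform matroid U_{2,4}. -/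
open Module in
/-- Subspaces of dimension at most `k` in a space of dimension `2 * k`, any two of which span the
whole space, form a multi-linear representation of a uniform matroid of rank two. -/
theorem Submodule.finrank_sum_of_pairwise_sup_eq_top {K W ι : Type*} [Field K] [AddCommGroup W]
    [Module K W] [FiniteDimensional K W] [Nontrivial ι] {k : ℕ} {V : ι → Submodule K W}
    (hW : finrank K W = 2 * k) (hle : ∀ i, finrank K (V i) ≤ k)
    (htop : ∀ i j, i ≠ j → V i ⊔ V j = ⊤) (X : Finset ι) :
    finrank K ↥(∑ i ∈ X, V i) = k * min X.card 2 := by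
  classical
  have hV (i : ι) : finrank K (V i) = k := by
    obtain ⟨j, hj⟩ := exists_ne i
    have h := Submodule.finrank_sup_add_finrank_inf_eq (V i) (V j)
    have h' := Submodule.finrank_add_le_finrank_add_finrank (V i) (V j)
    rw [htop i j hj.symm, finrank_top] at h'
    have := hle i
    have := hle j
    omega
  rcases lt_or_ge 1 X.card with h | h
  · obtain ⟨i, hi, j, hj, hij⟩ := Finset.one_lt_card.mp h
    have hX : ∑ i ∈ X, V i = ⊤ := by
      rw [eq_top_iff, ← htop i j hij]
      exact sup_le (Finset.single_le_sum_of_canonicallyOrdered hi)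
        (Finset.single_le_sum_of_canonicallyOrdered hj)
    rw [hX, finrank_top, hW, min_eq_right h, mul_comm]
  · rcases Nat.le_one_iff_eq_zero_or_eq_one.mp h with h | h
    · simp [Finset.card_eq_zero.mp h]
    · obtain ⟨i, rfl⟩ := Finset.card_eq_one.mp h
      rw [Finset.sum_singleton, hV]
      simp

/-- Bases of the four planes in the multi-linear representation of `U_{2,4}` over `F₂`. -/
def planeBasisU24 : Fin 4 → Fin 2 → Fin 4 → ZMod 2 :=
  ![![![1, 0, 0, 0], ![0, 1, 0, 0]], ![![0, 0, 1, 0], ![0, 0, 0, 1]],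
    ![![1, 0, 0, 1], ![0, 1, 1, 0]], ![![1, 0, 1, 1], ![0, 1, 0, 1]]]

set_option maxRecDepth 10000 in
theorem planeBasisU24_exists_combination : ∀ i j, i ≠ j → ∀ k, ∃ a b c d : ZMod 2,
    (a • planeBasisU24 i 0 + b • planeBasisU24 i 1) +
      (c • planeBasisU24 j 0 + d • planeBasisU24 j 1) = Pi.single k 1 := by
  decide

theorem span_planeBasisU24_sup_eq_top (i j : Fin 4) (hij : i ≠ j) :
    Submodule.span (ZMod 2) {planeBasisU24 i 0, planeBasisU24 i 1} ⊔
      Submodule.span (ZMod 2) {planeBasisU24 j 0, planeBasisU24 j 1} = ⊤ := by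
  rw [eq_top_iff, ← (Pi.basisFun (ZMod 2) (Fin 4)).span_eq, Submodule.span_le]
  rintro _ ⟨k, rfl⟩
  obtain ⟨a, b, c, d, h⟩ := planeBasisU24_exists_combination i j hij k
  rw [Pi.basisFun_apply, ← h]
  exact Submodule.add_mem_sup (Submodule.mem_span_pair.mpr ⟨a, b, rfl⟩)
    (Submodule.mem_span_pair.mpr ⟨c, d, rfl⟩)

/-- **A multi-linear representation of dimension 2 over `F₂` of `U_{2,4}`.**
With `e₁, e₂, e₃, e₄` the standard basis of `(F₂)⁴`, the subspaces
`V₁ = span{e₁, e₂}`, `V₂ = span{e₃, e₄}`, `V₃ = span{e₁+e₄, e₂+e₃}`,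
`V₄ = span{e₁+e₃+e₄, e₂+e₄}` satisfy `dim (∑ i ∈ X, V i) = 2·min(|X|, 2)`
for every `X ⊆ {1,2,3,4}`. -/
theorem multilinear_representation_U24_over_F2
    (e : Fin 4 → (Fin 4 → ZMod 2)) (he : ∀ i, e i = Pi.single i 1)
    (V : Fin 4 → Submodule (ZMod 2) (Fin 4 → ZMod 2))
    (hV : V = ![Submodule.span (ZMod 2) {e 0, e 1},
                Submodule.span (ZMod 2) {e 2, e 3},
                Submodule.span (ZMod 2) {e 0 + e 3, e 1 + e 2},
                Submodule.span (ZMod 2) {e 0 + e 2 + e 3, e 1 + e 3}]) :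
    ∀ X : Finset (Fin 4),
      Module.finrank (ZMod 2) ↥(∑ i ∈ X, V i) = if X.card ≤ 2 then 2 * X.card else 4 := by
  have hV' (i : Fin 4) :
      V i = Submodule.span (ZMod 2) {planeBasisU24 i 0, planeBasisU24 i 1} := by
    obtain rfl : e = fun i => Pi.single i 1 := funext he
    subst hV
    fin_cases i <;> refine congrArg₂ (fun v w => Submodule.span (ZMod 2) {v, w}) ?_ ?_ <;> decide
  intro X
  rw [Submodule.finrank_sum_of_pairwise_sup_eq_top (k := 2) (by simp)]
  · split_ifs <;> omega
  · intro i
    rw [hV']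
    have h := finrank_span_finset_le_card (R := ZMod 2)
      ({planeBasisU24 i 0, planeBasisU24 i 1} : Finset (Fin 4 → ZMod 2))
    rw [Finset.coe_pair] at h
    exact h.trans Finset.card_le_two
  · intro i j hij
    rw [hV', hV']
    exact span_planeBasisU24_sup_eq_top i j hij
end

section
/- Let W be a finite-dimensional vector space over a field F and let m_1, m_2, m_3, m_4, m_5, m_8, w ∈ W be such that m_1, m_2, m_3, m_4 are linearly independent, m_5 ∈ span{m_1, m_2}, m_8 ∈ span{m_3, m_4}, m_2 ∈ span{m_5, w}, and m_3 ∈ span{m_8, w}. Then dim(span{m_2, m_5}) + dim(span{m_3, m_8}) ≤ 3. (This is the step in the proof of Lemma 3 establishing g({2,5}) + g({3,8}) ≤ 3, obtained via the submodularity of dimension using the intermediate vector w, which is the encoding vector of edge 11.) -/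
open Submodule in
/-- Spans of the two halves of a linearly independent quadruple are disjoint. -/
theorem LinearIndependent.disjoint_span_pair_pair
    {F W : Type*} [Field F] [AddCommGroup W] [Module F W] {a b c d : W}
    (h : LinearIndependent F ![a, b, c, d]) :
    Disjoint (span F {a, b}) (span F {c, d}) := by
  have := h.disjoint_span_image (s := {0, 1}) (t := {2, 3}) (by simp)
  simpa [Set.image_pair] using this

open Submodule in
/-- A pair whose first vector is a multiple of the second spans at most a line. -/
theorem finrank_span_pair_le_one_of_mem
    {F W : Type*} [Field F] [AddCommGroup W] [Module F W] {x y : W}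
    (h : x ∈ span F {y}) : Module.finrank F (span F {x, y}) ≤ 1 := by
  rw [span_insert_eq_span h]
  simpa using finrank_span_le_card (R := F) ({y} : Set W)

open Submodule in
/-- Exchange property: either `x, y` span at most a line, or `w` lies in their span. -/
theorem finrank_span_pair_le_one_or_mem_span_pair
    {F W : Type*} [Field F] [AddCommGroup W] [Module F W] {x y w : W}
    (h : x ∈ span F {y, w}) :
    Module.finrank F (span F {x, y}) ≤ 1 ∨ w ∈ span F {x, y} := by
  by_cases hx : x ∈ span F {y}
  · exact .inl (finrank_span_pair_le_one_of_mem hx)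
  · rw [Set.pair_comm] at h
    exact .inr (mem_span_insert_exchange h hx)

open Submodule in
theorem finrank_span_pair_le_two
    {F W : Type*} [Field F] [AddCommGroup W] [Module F W] (x y : W) :
    Module.finrank F (span F {x, y}) ≤ 2 := by
  classical
  have := finrank_span_finset_le_card (R := F) ({x, y} : Finset W)
  rw [Finset.coe_pair] at this
  exact this.trans Finset.card_le_two

/-- If `m₁, m₂, m₃, m₄` are linearly independent, `m₅ ∈ span{m₁, m₂}`,
`m₈ ∈ span{m₃, m₄}`, `m₂ ∈ span{m₅, w}` and `m₃ ∈ span{m₈, w}`, then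
`dim span{m₂, m₅} + dim span{m₃, m₈} ≤ 3`. (The step in the proof of Lemma 3
establishing `g({2,5}) + g({3,8}) ≤ 3`, via submodularity of dimension using the
encoding vector `w` of edge 11.) -/
theorem finrank_span_add_finrank_span_le_three
    {F W : Type*} [Field F] [AddCommGroup W] [Module F W] [FiniteDimensional F W]
    (m₁ m₂ m₃ m₄ m₅ m₈ w : W)
    (hli : LinearIndependent F ![m₁, m₂, m₃, m₄])
    (h₅ : m₅ ∈ Submodule.span F {m₁, m₂})
    (h₈ : m₈ ∈ Submodule.span F {m₃, m₄})
    (h₂ : m₂ ∈ Submodule.span F {m₅, w})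
    (h₃ : m₃ ∈ Submodule.span F {m₈, w}) :
    Module.finrank F ↥(Submodule.span F {m₂, m₅})
      + Module.finrank F ↥(Submodule.span F {m₃, m₈}) ≤ 3 := by
  have key₂ := finrank_span_pair_le_two (F := F) m₂ m₅
  have key₃ := finrank_span_pair_le_two (F := F) m₃ m₈
  rcases finrank_span_pair_le_one_or_mem_span_pair h₂ with h | hw₂
  · omega
  rcases finrank_span_pair_le_one_or_mem_span_pair h₃ with h | hw₃
  · omega
  have hle₂ : Submodule.span F {m₂, m₅} ≤ Submodule.span F {m₁, m₂} :=
    Submodule.span_le.2 (Set.pair_subset (Submodule.subset_span (by simp)) h₅)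
  have hle₃ : Submodule.span F {m₃, m₈} ≤ Submodule.span F {m₃, m₄} :=
    Submodule.span_le.2 (Set.pair_subset (Submodule.subset_span (by simp)) h₈)
  obtain rfl : w = 0 :=
    Submodule.disjoint_def.1 hli.disjoint_span_pair_pair w (hle₂ hw₂) (hle₃ hw₃)
  rw [Set.pair_comm, Submodule.span_insert_zero] at h₂
  have := finrank_span_pair_le_one_of_mem h₂
  omega
end

section
/- Let e_1, …, e_8 be the standard basis of (F_2)^8, where F_2 is the field with two elements, and define the twelve subspaces V_1 = span{e_1,e_2}, V_2 = span{e_3,e_4}, V_3 = span{e_5,e_6}, V_4 = span{e_7,e_8}, V_5 = span{e_1,e_4}, V_6 = span{e_2,e_3}, V_7 = span{e_5,e_8}, V_8 = span{e_6,e_7}, V_9 = span{e_2,e_5}, V_10 = span{e_2,e_8}, V_11 = span{e_3,e_5}, V_12 = span{e_3,e_8}. Then there is no function r from subsets of {1,…,12} to ℤ_{≥0} satisfying the matroid rank axioms — (D1) monotonicity, (D2) submodularity, (D3) r(∅) = 0, and r(X) ≤ |X| for all X — such that dim(∑_{i∈X} V_i) = 2·r(X) for every X ⊆ {1,…,12}.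 In other words, the subspaces V_1, …, V_12 do not form a multi-linear representation of dimension 2 of any matroid. -/
/-- **The subspaces of equation (1) are not a multi-linear representation of dimension 2
of any matroid.** With `e₁, …, e₈` the standard basis of `(F₂)⁸` and the twelve subspaces
`V₁ = span{e₁,e₂}`, `V₂ = span{e₃,e₄}`, `V₃ = span{e₅,e₆}`, `V₄ = span{e₇,e₈}`,
`V₅ = span{e₁,e₄}`, `V₆ = span{e₂,e₃}`, `V₇ = span{e₅,e₈}`, `V₈ = span{e₆,e₇}`,
`V₉ = span{e₂,e₅}`, `V₁₀ = span{e₂,e₈}`, `V₁₁ = span{e₃,e₅}`, `V₁₂ = span{e₃,e₈}`,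
there is no function `r` satisfying the matroid rank axioms with
`dim (∑ i ∈ X, V i) = 2 * r X` for every `X`. -/
theorem no_matroid_rank_function_for_M_network_subspaces
    (e : Fin 8 → (Fin 8 → ZMod 2)) (he : ∀ i, e i = Pi.single i 1)
    (V : Fin 12 → Submodule (ZMod 2) (Fin 8 → ZMod 2))
    (hV : V = ![Submodule.span (ZMod 2) {e 0, e 1},
                Submodule.span (ZMod 2) {e 2, e 3},
                Submodule.span (ZMod 2) {e 4, e 5},
                Submodule.span (ZMod 2) {e 6, e 7},
                Submodule.span (ZMod 2) {e 0, e 3},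
                Submodule.span (ZMod 2) {e 1, e 2},
                Submodule.span (ZMod 2) {e 4, e 7},
                Submodule.span (ZMod 2) {e 5, e 6},
                Submodule.span (ZMod 2) {e 1, e 4},
                Submodule.span (ZMod 2) {e 1, e 7},
                Submodule.span (ZMod 2) {e 2, e 4},
                Submodule.span (ZMod 2) {e 2, e 7}]) :
    ¬ ∃ r : Finset (Fin 12) → ℕ,
        (∀ A B : Finset (Fin 12), A ⊆ B → r A ≤ r B) ∧
        (∀ A B : Finset (Fin 12), r (A ∪ B) + r (A ∩ B) ≤ r A + r B) ∧
        r ∅ = 0 ∧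
        (∀ X : Finset (Fin 12), r X ≤ X.card) ∧
        (∀ X : Finset (Fin 12),
          Module.finrank (ZMod 2) ↥(∑ i ∈ X, V i) = 2 * r X) := by
  rintro ⟨r, -, -, -, -, hr⟩
  obtain rfl : e = fun i => Pi.single i 1 := funext he
  have hind : LinearIndependent (ZMod 2)
      ((fun i : Fin 8 => (Pi.single i 1 : Fin 8 → ZMod 2)) ∘ ![0, 1, 3]) :=
    (Pi.linearIndependent_single_one (Fin 8) (ZMod 2)).comp _ (by decide)
  have hsum : ∑ i ∈ ({0, 4} : Finset (Fin 12)), V i = Submodule.span (ZMod 2)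
      (Set.range ((fun i : Fin 8 => (Pi.single i 1 : Fin 8 → ZMod 2)) ∘ ![0, 1, 3])) := by
    rw [Finset.sum_pair (by decide), hV, Set.range_comp, Submodule.add_eq_sup]
    simp only [Matrix.cons_val, ← Submodule.span_union]
    congr 1
    ext x
    simp only [Matrix.range_cons, Matrix.range_empty, Set.image_union, Set.image_singleton,
      Set.image_empty, Set.mem_union, Set.mem_insert_iff, Set.mem_singleton_iff,
      Set.mem_empty_iff_false]
    tauto
  have h := hr {0, 4}
  rw [hsum, finrank_span_eq_card hind, Fintype.card_fin] at h
  omega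
end
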